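/- arXiv:1410.0413 — 2 statements merged into one kernel-verified Lean document; each statement's English description precedes it below -/
import Mathlib

section
/- (Randomized coordinate descent rate) Let F : ℝ^n → ℝ be convex and differentiable, let A_1 ∈ ℝ^{n×k_1}, …, A_m ∈ ℝ^{n×k_m} have full column rank, let L_1, …, L_m > 0 be such that F is L_i-A_i-smooth for each i, and let p be a probability distribution on {1,…,m} with full support. Let A = Σ_i (p_i/L_i) A_i A_i^+, let x⁰ ∈ ℝ^n, X(A) = {x⁰ + Ay : y ∈ ℝ^n}, assume F attains its minimum F_min on X(A), and assume R²(x⁰) is finite. Let (i_t)_{t≥0} be i.i.d. with law p and define x^{t+1} = x^t − (1/L_{i_t}) A_{i_t} A_{i_t}^+ ∇F(x^t). Then for all t ≥ 1, E[F(x^t)] − F_min ≤ 2R²(x⁰)/t. -/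
open Matrix

/-- The four Penrose conditions characterizing the Moore–Penrose pseudoinverse. -/
def IsMoorePenroseInv {m n : Type*} [Fintype m] [Fintype n]
    (A : Matrix m n ℝ) (B : Matrix n m ℝ) : Prop :=
  A * B * A = A ∧ B * A * B = B ∧ (A * B)ᵀ = A * B ∧ (B * A)ᵀ = B * A

open scoped Classical in
/-- The Moore–Penrose pseudoinverse `A^+` of a real matrix `A`. -/
noncomputable def pinv {m n : Type*} [Fintype m] [Fintype n]
    (A : Matrix m n ℝ) : Matrix n m ℝ :=
  if h : ∃ B, IsMoorePenroseInv A B then h.choose else 0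

/-- The Euclidean dot product on `ℝ^n`. -/
def dotp {n : ℕ} (x y : Fin n → ℝ) : ℝ := ∑ i, x i * y i

/-- The continuous linear functional `y ↦ ⟨g, y⟩` on `ℝ^n`. -/
noncomputable def dotCLM {n : ℕ} (g : Fin n → ℝ) : (Fin n → ℝ) →L[ℝ] ℝ :=
  ∑ i, g i • ContinuousLinearMap.proj i

/-- The trajectory of an iterative algorithm: `traj x0 step t ω` is the state after `t`
steps started from `x0`, where the `s`-th step uses the random index `ω s`. -/
def traj {α : Type*} {m : ℕ} (x0 : α) (step : α → Fin m → α) :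
    (t : ℕ) → (Fin t → Fin m) → α
  | 0, _ => x0
  | t + 1, ω => step (traj x0 step t fun s => ω s.castSucc) (ω (Fin.last t))

theorem exists_isMoorePenroseInv_of_isHermitian {n : Type*} [Fintype n] {S : Matrix n n ℝ}
    (hS : S.IsHermitian) : ∃ B, IsMoorePenroseInv S B ∧ Bᵀ = B := by
  classical
  set U : Matrix n n ℝ := (hS.eigenvectorUnitary : Matrix n n ℝ)
  set d := hS.eigenvalues
  have hUU : Uᵀ * U = 1 := by
    have := Unitary.coe_star_mul_self hS.eigenvectorUnitary
    simpa [star_eq_conjTranspose] using this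
  have hspec : S = U * diagonal d * Uᵀ := by
    have := hS.spectral_theorem
    rw [Unitary.conjStarAlgAut_apply] at this
    simpa [star_eq_conjTranspose, Function.comp_def] using this
  have hmul (a b : n → ℝ) : (U * diagonal a * Uᵀ) * (U * diagonal b * Uᵀ) =
      U * diagonal (fun i => a i * b i) * Uᵀ := by
    calc _ = U * diagonal a * (Uᵀ * U) * diagonal b * Uᵀ := by simp only [Matrix.mul_assoc]
      _ = _ := by rw [hUU, Matrix.mul_one, Matrix.mul_assoc U, diagonal_mul_diagonal]
  have htr (a : n → ℝ) : (U * diagonal a * Uᵀ)ᵀ = U * diagonal a * Uᵀ := by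
    simp [transpose_mul, Matrix.mul_assoc]
  refine ⟨U * diagonal (fun i => (d i)⁻¹) * Uᵀ, ?_, htr _⟩
  rw [hspec]
  refine ⟨?_, ?_, ?_, ?_⟩ <;> simp only [hmul, htr]
  · simp
  · have h (i : n) : (d i)⁻¹ * d i * (d i)⁻¹ = (d i)⁻¹ := by
      simpa using mul_inv_mul_cancel (d i)⁻¹
    simp only [h]

/-- Every real matrix has a Moore–Penrose pseudoinverse, namely `(AᵀA)⁺Aᵀ`. -/
theorem exists_isMoorePenroseInv {m n : Type*} [Fintype m] [Fintype n] (A : Matrix m n ℝ) :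
    ∃ B, IsMoorePenroseInv A B := by
  classical
  obtain ⟨B, ⟨h₁, h₂, -, h₄⟩, hB⟩ := exists_isMoorePenroseInv_of_isHermitian
    (S := Aᵀ * A) (by simp [IsHermitian, conjTranspose_eq_transpose_of_trivial])
  refine ⟨B * Aᵀ, ?_, ?_, ?_, ?_⟩
  · have h : Aᴴ * A * (B * (Aᵀ * A) - 1) = 0 := by
      rw [conjTranspose_eq_transpose_of_trivial, Matrix.mul_sub, ← Matrix.mul_assoc, h₁,
        Matrix.mul_one, sub_self]
    rw [conjTranspose_mul_self_mul_eq_zero, Matrix.mul_sub, Matrix.mul_one, sub_eq_zero] at h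
    simpa only [Matrix.mul_assoc] using h
  · calc B * Aᵀ * A * (B * Aᵀ) = B * (Aᵀ * A) * B * Aᵀ := by simp only [Matrix.mul_assoc]
      _ = B * Aᵀ := by rw [h₂]
  · simp [transpose_mul, hB, Matrix.mul_assoc]
  · rw [Matrix.mul_assoc, h₄]

theorem isMoorePenroseInv_pinv {m n : Type*} [Fintype m] [Fintype n] (A : Matrix m n ℝ) :
    IsMoorePenroseInv A (pinv A) := by
  rw [pinv, dif_pos (exists_isMoorePenroseInv A)]
  exact (exists_isMoorePenroseInv A).choose_spec

section Projection

variable {m n : Type*} [Fintype m] [Fintype n]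

theorem transpose_mul_pinv (A : Matrix m n ℝ) : (A * pinv A)ᵀ = A * pinv A :=
  (isMoorePenroseInv_pinv A).2.2.1

theorem mul_pinv_mul_mul_pinv (A : Matrix m n ℝ) : A * pinv A * (A * pinv A) = A * pinv A := by
  rw [← Matrix.mul_assoc, (isMoorePenroseInv_pinv A).1]

theorem mul_pinv_mulVec_dotProduct_self (A : Matrix m n ℝ) (v : m → ℝ) :
    (A * pinv A) *ᵥ v ⬝ᵥ (A * pinv A) *ᵥ v = v ⬝ᵥ (A * pinv A) *ᵥ v := by
  rw [dotProduct_mulVec, ← mulVec_transpose, transpose_mul_pinv, mulVec_mulVec,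
    mul_pinv_mul_mul_pinv, dotProduct_comm]

end Projection

/-- The range of a positive combination of orthogonal projections contains the range of each
of them. -/
theorem mul_pinv_mul_of_eq_sum {n ι : Type*} [Fintype n] [Fintype ι] {M : Matrix n n ℝ}
    {c : ι → ℝ} (hc : ∀ i, 0 < c i) {P : ι → Matrix n n ℝ} (hPT : ∀ i, (P i)ᵀ = P i)
    (hPP : ∀ i, P i * P i = P i) (hM : M = ∑ i, c i • P i) (i : ι) :
    M * pinv M * P i = P i := by
  classical
  have hMT : Mᵀ = M := by simp [hM, transpose_sum, hPT]
  set Q := 1 - M * pinv M with hQ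
  have hQT : Qᵀ = Q := by rw [hQ, transpose_sub, transpose_mul_pinv, transpose_one]
  have hQM : Q * M = 0 := by
    rw [hQ, Matrix.sub_mul, Matrix.one_mul, (isMoorePenroseInv_pinv M).1, sub_self]
  have hMQ : M * Q = 0 := by
    simpa [transpose_mul, hMT, hQT] using congrArg transpose hQM
  have hPQ : P i * Q = 0 := by
    refine Matrix.ext_of_mulVec_single fun j => ?_
    set v := Q *ᵥ Pi.single j 1 with hv
    have hMv : M *ᵥ v = 0 := by rw [hv, mulVec_mulVec, hMQ, zero_mulVec]
    have hnorm (i : ι) : v ⬝ᵥ P i *ᵥ v = P i *ᵥ v ⬝ᵥ P i *ᵥ v := by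
      conv_rhs => rw [dotProduct_mulVec, ← mulVec_transpose, hPT, mulVec_mulVec, hPP,
        dotProduct_comm]
    have hsum : ∑ i, c i * (P i *ᵥ v ⬝ᵥ P i *ᵥ v) = 0 := by
      have h : v ⬝ᵥ M *ᵥ v = 0 := by rw [hMv, dotProduct_zero]
      rw [hM, sum_mulVec, dotProduct_sum] at h
      simpa [smul_mulVec, hnorm] using h
    have h := (Finset.sum_eq_zero_iff_of_nonneg fun i _ => mul_nonneg (hc i).le
      (by simpa using dotProduct_star_self_nonneg (P i *ᵥ v))).1 hsum i (Finset.mem_univ i)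
    rw [mul_eq_zero, or_iff_right (hc i).ne', dotProduct_self_eq_zero] at h
    rw [← mulVec_mulVec, ← hv, h, zero_mulVec]
  have hQP : Q * P i = 0 := by
    simpa [transpose_mul, hPT, hQT] using congrArg transpose hPQ
  rw [hQ, Matrix.sub_mul, Matrix.one_mul, sub_eq_zero] at hQP
  exact hQP.symm

/-- **Cauchy–Schwarz** for the seminorm of a symmetric positive semidefinite matrix. -/
theorem sq_dotProduct_mulVec_le {n : Type*} [Fintype n] {M : Matrix n n ℝ} (hMT : Mᵀ = M)
    (hM : ∀ v, 0 ≤ v ⬝ᵥ M *ᵥ v) (x y : n → ℝ) :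
    (x ⬝ᵥ M *ᵥ y) ^ 2 ≤ (x ⬝ᵥ M *ᵥ x) * (y ⬝ᵥ M *ᵥ y) := by
  classical
  have h := LinearMap.BilinForm.apply_sq_le_of_symm (Matrix.toLinearMap₂' ℝ M)
    (by simpa [Matrix.toLinearMap₂'_apply'] using hM)
    ⟨fun x y => by
      simp only [Matrix.toLinearMap₂'_apply', RingHom.id_apply]
      rw [dotProduct_mulVec, ← mulVec_transpose, hMT, dotProduct_comm]⟩ x y
  simpa only [Matrix.toLinearMap₂'_apply'] using h

/-- The first-order characterization of convexity. -/
theorem ConvexOn.add_fderiv_le {E : Type*} [NormedAddCommGroup E] [NormedSpace ℝ E] {F : E → ℝ}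
    (hF : ConvexOn ℝ Set.univ F) {F' : E →L[ℝ] ℝ} {x : E} (hx : HasFDerivAt F F' x) (y : E) :
    F x + F' (y - x) ≤ F y := by
  have hconv : ConvexOn ℝ Set.univ (F ∘ AffineMap.lineMap (k := ℝ) x y) := by
    simpa using hF.comp_affineMap (AffineMap.lineMap (k := ℝ) x y)
  have hderiv : HasDerivAt (F ∘ AffineMap.lineMap (k := ℝ) x y) (F' (y - x)) 0 :=
    HasFDerivAt.comp_hasDerivAt 0 (by simpa using hx) AffineMap.hasDerivAt_lineMap
  have h := hconv.le_slope_of_hasDerivAt (Set.mem_univ 0) (Set.mem_univ 1) one_pos hderiv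
  simp [slope_def_field, -map_sub] at h
  linarith

theorem dotCLM_apply {n : ℕ} (g v : Fin n → ℝ) : dotCLM g v = g ⬝ᵥ v := by
  simp [dotCLM, dotProduct]

section Expectation

variable {α : Type*} {m : ℕ}

/-- Conditioning on the first `t` indices. -/
theorem sum_prod_mul_traj_succ (p : Fin m → ℝ) (f : α → ℝ) (x0 : α) (step : α → Fin m → α)
    (t : ℕ) :
    ∑ ω : Fin (t + 1) → Fin m, (∏ s, p (ω s)) * f (traj x0 step (t + 1) ω) =
      ∑ ω : Fin t → Fin m, (∏ s, p (ω s)) * ∑ i, p i * f (step (traj x0 step t ω) i) := by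
  rw [← (Fin.snocEquiv fun _ => Fin m).sum_comp, Fintype.sum_prod_type, Finset.sum_comm]
  refine Finset.sum_congr rfl fun ω _ => ?_
  rw [Finset.mul_sum]
  refine Finset.sum_congr rfl fun i _ => ?_
  simp [Fin.prod_univ_castSucc, traj, Fin.snocEquiv, mul_assoc]

theorem traj_induction {x0 : α} {step : α → Fin m → α} {C : α → Prop} (h0 : C x0)
    (hstep : ∀ x i, C x → C (step x i)) : ∀ (t : ℕ) (ω : Fin t → Fin m), C (traj x0 step t ω)
  | 0, _ => h0
  | t + 1, _ => hstep _ _ (traj_induction h0 hstep t _)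

theorem sum_prod_eq_one {p : Fin m → ℝ} (hpsum : ∑ i, p i = 1) (t : ℕ) :
    ∑ ω : Fin t → Fin m, ∏ s, p (ω s) = 1 := by
  rw [← Fintype.piFinset_univ, ← Finset.prod_univ_sum (fun _ => Finset.univ) (fun _ j => p j)]
  simp [hpsum]

/-- A pointwise quadratic decrease in conditional expectation yields, by Jensen's inequality, the
same decrease of the expectations. -/
theorem expect_traj_succ_le {p : Fin m → ℝ} (hp : ∀ i, 0 ≤ p i) (hpsum : ∑ i, p i = 1)
    {x0 : α} {step : α → Fin m → α} {C : α → Prop} (h0 : C x0)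
    (hstep : ∀ x i, C x → C (step x i)) {f : α → ℝ} {c : ℝ}
    (hf : ∀ x, C x → c * ∑ i, p i * f (step x i) ≤ c * f x - f x ^ 2) (t : ℕ) :
    c * ∑ ω : Fin (t + 1) → Fin m, (∏ s, p (ω s)) * f (traj x0 step (t + 1) ω) ≤
      c * (∑ ω : Fin t → Fin m, (∏ s, p (ω s)) * f (traj x0 step t ω)) -
        (∑ ω : Fin t → Fin m, (∏ s, p (ω s)) * f (traj x0 step t ω)) ^ 2 := by
  have hw (ω : Fin t → Fin m) : 0 ≤ ∏ s, p (ω s) := Finset.prod_nonneg fun s _ => hp _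
  have hjensen := Real.pow_arith_mean_le_arith_mean_pow_of_even Finset.univ
    (fun ω : Fin t → Fin m => ∏ s, p (ω s)) (fun ω => f (traj x0 step t ω)) (fun ω _ => hw ω)
    (sum_prod_eq_one hpsum t) even_two
  have hsum : c * ∑ ω : Fin (t + 1) → Fin m, (∏ s, p (ω s)) * f (traj x0 step (t + 1) ω) ≤
      ∑ ω : Fin t → Fin m, (∏ s, p (ω s)) *
        (c * f (traj x0 step t ω) - f (traj x0 step t ω) ^ 2) := by
    rw [sum_prod_mul_traj_succ, Finset.mul_sum]
    refine Finset.sum_le_sum fun ω _ => ?_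
    rw [mul_left_comm]
    exact mul_le_mul_of_nonneg_left (hf _ (traj_induction h0 hstep t ω)) (hw ω)
  simp only [mul_sub, Finset.sum_sub_distrib, mul_left_comm _ c, ← Finset.mul_sum] at hsum
  linarith

end Expectation

/-- A nonnegative sequence with `c Δₜ₊₁ ≤ c Δₜ - Δₜ²` decays like `c / t`. -/
theorem natCast_mul_le_of_quadratic_decrease {c : ℝ} (hc : 0 ≤ c) {Δ : ℕ → ℝ}
    (hΔ : ∀ t, 0 ≤ Δ t) (h : ∀ t, c * Δ (t + 1) ≤ c * Δ t - Δ t ^ 2) (t : ℕ) :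
    t * Δ t ≤ c := by
  rcases hc.eq_or_lt with rfl | hc
  · have : Δ t = 0 := by
      have := h t
      simp only [zero_mul] at this
      exact pow_eq_zero_iff two_ne_zero |>.1 (le_antisymm (by linarith) (sq_nonneg _))
    simp [this]
  induction t with
  | zero => simpa using hc.le
  | succ t ih =>
    have hle : Δ t ≤ c := by
      by_contra! hlt
      nlinarith [h t, mul_nonneg hc.le (hΔ (t + 1)), mul_pos (hc.trans hlt) (sub_pos.2 hlt)]
    push_cast
    have h1 : c * ((t + 1) * Δ (t + 1)) ≤ (t + 1) * (c * Δ t - Δ t ^ 2) := by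
      have := mul_le_mul_of_nonneg_left (h t) (by positivity : (0 : ℝ) ≤ t + 1)
      linarith
    have h2 : (t + 1) * (c * Δ t - Δ t ^ 2) ≤ c * c := by
      nlinarith [mul_nonneg (sub_nonneg.2 ih) (sub_nonneg.2 hle), sq_nonneg (Δ t)]
    exact le_of_mul_le_mul_left (h1.trans h2) hc

/-- One coordinate step decreases a function that is smooth along the range of `A`. -/
theorem coordinate_step_le {n k : ℕ} {F : (Fin n → ℝ) → ℝ} {A : Matrix (Fin n) (Fin k) ℝ} {L : ℝ}
    (hL : 0 < L) {x g : Fin n → ℝ}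
    (hsmooth : ∀ y ∈ Set.range A.mulVec, F (x + y) ≤ F x + dotp g y + L / 2 * dotp y y) :
    F (x - (1 / L) • (A * pinv A) *ᵥ g) ≤ F x - 1 / (2 * L) * (g ⬝ᵥ (A * pinv A) *ᵥ g) := by
  have h := hsmooth (-((1 / L) • (A * pinv A) *ᵥ g))
    ⟨pinv A *ᵥ (-((1 / L) • g)), by rw [mulVec_mulVec, mulVec_neg, mulVec_smul]⟩
  rw [← sub_eq_add_neg] at h
  refine h.trans_eq ?_
  change F x + g ⬝ᵥ _ + L / 2 * (_ ⬝ᵥ _) = _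
  rw [neg_dotProduct_neg, dotProduct_neg, smul_dotProduct, dotProduct_smul, dotProduct_smul,
    mul_pinv_mulVec_dotProduct_self]
  simp only [smul_eq_mul]
  field_simp
  ring

/-- **Randomized coordinate descent rate.**
Let `F : ℝ^n → ℝ` be convex and differentiable with gradient `∇F`, let
`A_1, …, A_m` have full column rank, `L_i > 0` with `F` `L_i`-`A_i`-smooth, and `p` a
full-support probability distribution on `{1,…,m}`. With `A = Σ_i (p_i/L_i) A_i A_i^+`,
`X(A) = {x⁰ + Ay}`, assume `F` attains its minimum `F_min` on `X(A)` and that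
`R²(x⁰)` (the maximal squared dual seminorm distance from the sublevel set of `x⁰` in
`X(A)` to the minimizers) is bounded by a finite `R2`. If `(i_t)` are i.i.d. with law
`p` and `x^{t+1} = x^t − (1/L_{i_t}) A_{i_t} A_{i_t}^+ ∇F(x^t)`, then for all `t ≥ 1`,
`E[F(x^t)] − F_min ≤ 2R²(x⁰)/t`; the expectation is the average over all length-`t`
index sequences weighted by their probabilities. -/
theorem randomized_coordinate_descent_rate {n m : ℕ} (k : Fin m → ℕ)
    (F : (Fin n → ℝ) → ℝ) (hF : ConvexOn ℝ Set.univ F)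
    (gF : (Fin n → ℝ) → Fin n → ℝ)
    (hgrad : ∀ x, HasFDerivAt F (dotCLM (gF x)) x)
    (A : (i : Fin m) → Matrix (Fin n) (Fin (k i)) ℝ)
    (hrank : ∀ i, (A i).rank = k i)
    (L : Fin m → ℝ) (hL : ∀ i, 0 < L i)
    (hsmooth : ∀ i, ∀ x : Fin n → ℝ, ∀ y ∈ Set.range (A i).mulVec,
      F (x + y) ≤ F x + dotp (gF x) y + L i / 2 * dotp y y)
    (p : Fin m → ℝ) (hp : ∀ i, 0 < p i) (hpsum : ∑ i, p i = 1)
    (x0 : Fin n → ℝ)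
    (Amat : Matrix (Fin n) (Fin n) ℝ)
    (hAmat : Amat = ∑ i, (p i / L i) • (A i * pinv (A i)))
    (XA : Set (Fin n → ℝ)) (hXA : XA = {x | ∃ y : Fin n → ℝ, x = x0 + Amat.mulVec y})
    (Fmin : ℝ)
    (hFmin : (∃ x ∈ XA, F x = Fmin) ∧ ∀ x ∈ XA, Fmin ≤ F x)
    (R2 : ℝ)
    (hR2 : ∀ x ∈ XA, F x ≤ F x0 → ∀ xstar ∈ XA, F xstar = Fmin →
      dotp ((pinv Amat).mulVec (x - xstar)) (x - xstar) ≤ R2) :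
    ∀ t : ℕ, 1 ≤ t →
      (∑ ω : Fin t → Fin m, (∏ s, p (ω s)) *
          F (traj x0
            (fun x i => x - (1 / L i) • (A i * pinv (A i)).mulVec (gF x)) t ω)) - Fmin ≤
        2 * R2 / t := by
  intro t ht
  set P : Fin m → Matrix (Fin n) (Fin n) ℝ := fun i => A i * pinv (A i) with hP
  set step : (Fin n → ℝ) → Fin m → Fin n → ℝ :=
    fun x i => x - (1 / L i) • (A i * pinv (A i)).mulVec (gF x)
  have hc (i : Fin m) : 0 < p i / L i := div_pos (hp i) (hL i)
  have hPT (i : Fin m) : (P i)ᵀ = P i := transpose_mul_pinv _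
  have hPnonneg (i : Fin m) (v : Fin n → ℝ) : 0 ≤ v ⬝ᵥ P i *ᵥ v := by
    rw [hP, ← mul_pinv_mulVec_dotProduct_self]
    simpa using dotProduct_star_self_nonneg ((A i * pinv (A i)) *ᵥ v)
  have hMT : Amatᵀ = Amat := by
    rw [hAmat, transpose_sum]
    exact Finset.sum_congr rfl fun i _ => by rw [transpose_smul, transpose_mul_pinv]
  have hMform (v : Fin n → ℝ) : v ⬝ᵥ Amat *ᵥ v = ∑ i, p i / L i * (v ⬝ᵥ P i *ᵥ v) := by
    simp [hAmat, hP, sum_mulVec, dotProduct_sum, smul_mulVec]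
  have hMnonneg (v : Fin n → ℝ) : 0 ≤ v ⬝ᵥ Amat *ᵥ v := by
    rw [hMform]
    exact Finset.sum_nonneg fun i _ => mul_nonneg (hc i).le (hPnonneg i v)
  have hrange (i : Fin m) : Amat * pinv Amat * P i = P i :=
    mul_pinv_mul_of_eq_sum hc hPT (fun i => mul_pinv_mul_mul_pinv _) hAmat i
  have hdescent (x : Fin n → ℝ) (i : Fin m) :
      F (step x i) ≤ F x - 1 / (2 * L i) * (gF x ⬝ᵥ P i *ᵥ gF x) :=
    coordinate_step_le (hL i) (hsmooth i x)
  have hx0 : x0 ∈ XA ∧ F x0 ≤ F x0 := by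
    rw [hXA]
    exact ⟨⟨0, by simp⟩, le_rfl⟩
  have hinv (x : Fin n → ℝ) (i : Fin m) (hx : x ∈ XA ∧ F x ≤ F x0) :
      step x i ∈ XA ∧ F (step x i) ≤ F x0 := by
    refine ⟨?_, ?_⟩
    · obtain ⟨hx, -⟩ := hx
      rw [hXA] at hx ⊢
      obtain ⟨y, hy⟩ := hx
      refine ⟨y - (1 / L i) • (pinv Amat * P i) *ᵥ gF x, ?_⟩
      rw [mulVec_sub, mulVec_smul, mulVec_mulVec, ← Matrix.mul_assoc, hrange]
      change x - _ = _
      rw [hy, add_sub_assoc]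
    · have := mul_nonneg (one_div_pos.2 (mul_pos two_pos (hL i))).le (hPnonneg i (gF x))
      linarith [hdescent x i, hx.2]
  obtain ⟨⟨xs, hxs, hFxs⟩, hmin⟩ := hFmin
  have hdist {x : Fin n → ℝ} (hx : x ∈ XA ∧ F x ≤ F x0) :
      ∃ z, x - xs = Amat *ᵥ z ∧ z ⬝ᵥ Amat *ᵥ z ≤ R2 := by
    have h := hR2 x hx.1 hx.2 xs hxs hFxs
    obtain ⟨hx, -⟩ := hx
    rw [hXA] at hx hxs
    obtain ⟨y, hy⟩ := hx
    obtain ⟨w, hw⟩ := hxs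
    have hz : x - xs = Amat *ᵥ (y - w) := by rw [hy, hw, mulVec_sub, add_sub_add_left_eq_sub]
    refine ⟨y - w, hz, le_of_eq_of_le ?_ h⟩
    change _ = pinv Amat *ᵥ _ ⬝ᵥ _
    rw [hz, dotProduct_mulVec (pinv Amat *ᵥ _), ← mulVec_transpose, hMT, mulVec_mulVec, mulVec_mulVec,
      (isMoorePenroseInv_pinv Amat).1, dotProduct_comm]
  have hR2nonneg : 0 ≤ R2 := by
    obtain ⟨z, -, hz⟩ := hdist hx0
    exact (hMnonneg z).trans hz
  have hdecrease (x : Fin n → ℝ) (hx : x ∈ XA ∧ F x ≤ F x0) :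
      2 * R2 * ∑ i, p i * (F (step x i) - Fmin) ≤
        2 * R2 * (F x - Fmin) - (F x - Fmin) ^ 2 := by
    set q := gF x ⬝ᵥ Amat *ᵥ gF x
    have hgap : (F x - Fmin) ^ 2 ≤ q * R2 := by
      obtain ⟨z, hz, hzR⟩ := hdist hx
      have hconv := hF.add_fderiv_le (hgrad x) xs
      rw [dotCLM_apply, ← neg_sub x xs, dotProduct_neg, hz, hFxs] at hconv
      calc (F x - Fmin) ^ 2 ≤ (gF x ⬝ᵥ Amat *ᵥ z) ^ 2 :=
            pow_le_pow_left₀ (sub_nonneg.2 (hmin x hx.1)) (by linarith) 2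
        _ ≤ q * (z ⬝ᵥ Amat *ᵥ z) := sq_dotProduct_mulVec_le hMT hMnonneg _ _
        _ ≤ q * R2 := mul_le_mul_of_nonneg_left hzR (hMnonneg _)
    have hmean : ∑ i, p i * (F (step x i) - Fmin) ≤ F x - Fmin - q / 2 := by
      calc ∑ i, p i * (F (step x i) - Fmin)
          ≤ ∑ i, (p i * (F x - Fmin) - p i / L i * (gF x ⬝ᵥ P i *ᵥ gF x) / 2) := by
            refine Finset.sum_le_sum fun i _ => ?_
            refine (mul_le_mul_of_nonneg_left (sub_le_sub_right (hdescent x i) Fmin)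
              (hp i).le).trans_eq ?_
            have := (hL i).ne'
            field_simp
            ring
        _ = F x - Fmin - q / 2 := by
            rw [Finset.sum_sub_distrib, ← Finset.sum_mul, hpsum, one_mul, ← Finset.sum_div,
              ← hMform]
    have := mul_le_mul_of_nonneg_left hmean (mul_nonneg two_pos.le hR2nonneg)
    linarith
  let C : (Fin n → ℝ) → Prop := fun x => x ∈ XA ∧ F x ≤ F x0
  have hrate := natCast_mul_le_of_quadratic_decrease (mul_nonneg two_pos.le hR2nonneg)
    (Δ := fun t => ∑ ω : Fin t → Fin m, (∏ s, p (ω s)) * (F (traj x0 step t ω) - Fmin))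
    (fun t => Finset.sum_nonneg fun ω _ => mul_nonneg (Finset.prod_nonneg fun s _ => (hp _).le)
      (sub_nonneg.2 (hmin _ (traj_induction (C := C) hx0 hinv t ω).1)))
    (expect_traj_succ_le (C := C) (f := fun x => F x - Fmin) (fun i => (hp i).le) hpsum hx0 hinv
      hdecrease) t
  simp only [mul_sub, Finset.sum_sub_distrib, ← Finset.sum_mul, sum_prod_eq_one hpsum,
    one_mul] at hrate
  rw [le_div_iff₀ (by exact_mod_cast ht)]
  linarith
end

section
/- (Equilibrium with scaled risk measures) Let ρ be an expressive, strictly risk averse convex risk measure on ℝ^k, let b_1, …, b_N > 0, define ρ_i(r) = b_i ρ(r/b_i), let r^0_1, …, r^0_N ∈ ℝ^k be initial positions with r⁰ = Σ_i r^0_i, and define r ∈ (ℝ^k)^N by r_i = b_i r⁰ / (Σ_j b_j). Then: (a) ∇ρ_i(r_i) = ∇ρ(r⁰ / Σ_j b_j) for every i; (b) Φ(r) = 0; and (c) r is the unique point with Σ_i r_i = r⁰ and Φ(r) = 0, up to zero-sum cash transfers (i.e., any other such point has coordinates r_i + c_i·r^$ with Σ_i c_i = 0). -/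
open scoped RealInnerProductSpace

/-- A (normalized) convex monetary risk measure on positions `r ∈ ℝ^k`, where the
position `r` pays `⟨r, φ(ω)⟩` on outcome `ω` and `rcash` is the riskless bundle
paying `1` on every outcome. -/
structure IsConvexRiskMeasure {k : ℕ} {Ω : Type*} [Fintype Ω]
    (φ : Ω → EuclideanSpace ℝ (Fin k)) (rcash : EuclideanSpace ℝ (Fin k))
    (ρ : EuclideanSpace ℝ (Fin k) → ℝ) : Prop where
  monotone : ∀ r r' : EuclideanSpace ℝ (Fin k),
    (∀ ω, ⟪r, φ ω⟫ ≤ ⟪r', φ ω⟫) → ρ r' ≤ ρ r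
  cash_invariant : ∀ (r : EuclideanSpace ℝ (Fin k)) (c : ℝ), ρ (r + c • rcash) = ρ r - c
  convex : ConvexOn ℝ Set.univ ρ
  normalized : ρ 0 = 0

/-- `ρ` is expressive: everywhere differentiable, with gradient range dense in `−Π`,
where `Π = conv(φ(Ω))`. -/
def Expressive {k : ℕ} {Ω : Type*} [Fintype Ω]
    (φ : Ω → EuclideanSpace ℝ (Fin k)) (ρ : EuclideanSpace ℝ (Fin k) → ℝ) : Prop :=
  (∀ x, DifferentiableAt ℝ ρ x) ∧
    closure (Set.range fun x => gradient ρ x) =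
      (fun π => -π) '' convexHull ℝ (Set.range φ)

/-- `ρ` is strictly risk averse: the convexity inequality is strict unless the
difference of the two positions is a multiple of the riskless bundle `rcash`. -/
def StrictlyRiskAverse {k : ℕ} (rcash : EuclideanSpace ℝ (Fin k))
    (ρ : EuclideanSpace ℝ (Fin k) → ℝ) : Prop :=
  ∀ r r' : EuclideanSpace ℝ (Fin k), ∀ t : ℝ, t ∈ Set.Ioo (0 : ℝ) 1 →
    (∀ c : ℝ, r - r' ≠ c • rcash) →
      ρ (t • r + (1 - t) • r') < t * ρ r + (1 - t) * ρ r'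

/-- The infimal convolution `(∧_{i∈S} ρ_i)(r) = inf {Σ_{i∈S} ρ_i(r_i) : Σ_{i∈S} r_i = r}`
of the risk measures indexed by `S`. -/
noncomputable def wedgeRisk {k N : ℕ} (S : Finset (Fin N))
    (ρ : Fin N → EuclideanSpace ℝ (Fin k) → ℝ) (r : EuclideanSpace ℝ (Fin k)) : ℝ :=
  sInf {s : ℝ | ∃ rs : Fin N → EuclideanSpace ℝ (Fin k),
    (∑ i ∈ S, rs i) = r ∧ s = ∑ i ∈ S, ρ i (rs i)}

/-- The `S`-surplus `Φ_S(r_S) = Σ_{i∈S} ρ_i(r_i) − (∧_{i∈S} ρ_i)(Σ_{i∈S} r_i)`. -/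
noncomputable def surplus {k N : ℕ} (S : Finset (Fin N))
    (ρ : Fin N → EuclideanSpace ℝ (Fin k) → ℝ)
    (r : Fin N → EuclideanSpace ℝ (Fin k)) : ℝ :=
  (∑ i ∈ S, ρ i (r i)) - wedgeRisk S ρ (∑ i ∈ S, r i)

/-- A trade function on `S`: it preserves the total position of `S`, allocates the whole
`S`-surplus, and leaves agents outside `S` untouched. -/
def IsTradeFunction {k N : ℕ} (S : Finset (Fin N))
    (ρ : Fin N → EuclideanSpace ℝ (Fin k) → ℝ)
    (f : (Fin N → EuclideanSpace ℝ (Fin k)) → Fin N → EuclideanSpace ℝ (Fin k)) : Prop :=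
  ∀ r, (∑ i ∈ S, f r i) = (∑ i ∈ S, r i) ∧ surplus S ρ (f r) = 0 ∧
    ∀ j ∉ S, f r j = r j

/-- Rescaling a function as `x ↦ b f(b⁻¹ x)` rescales its gradient only in the argument. -/
theorem gradient_scaled {k : ℕ} {f : EuclideanSpace ℝ (Fin k) → ℝ}
    (hf : ∀ x, DifferentiableAt ℝ f x) {b : ℝ} (hb : b ≠ 0) (x : EuclideanSpace ℝ (Fin k)) :
    gradient (fun y => b * f (b⁻¹ • y)) x = gradient f (b⁻¹ • x) := by
  have hlin : HasFDerivAt (fun y : EuclideanSpace ℝ (Fin k) => b⁻¹ • y)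
      (b⁻¹ • ContinuousLinearMap.id ℝ _) x := (hasFDerivAt_id x).const_smul b⁻¹
  have h := ((hf (b⁻¹ • x)).hasFDerivAt.comp x hlin).const_mul b
  have hfd : fderiv ℝ (fun y => b * f (b⁻¹ • y)) x = fderiv ℝ f (b⁻¹ • x) := by
    refine h.fderiv.trans ?_
    ext v
    simp [hb]
  simp only [gradient, hfd]

/-- Jensen's inequality for the scaled functions `x ↦ b_i f(b_i⁻¹ x)`. -/
theorem ConvexOn.sum_mul_le_sum_scaled {ι E : Type*} [Fintype ι] [AddCommGroup E] [Module ℝ E]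
    {f : E → ℝ} (hf : ConvexOn ℝ Set.univ f) {b : ι → ℝ} (hb : ∀ i, 0 < b i)
    (hB : 0 < ∑ i, b i) (x : ι → E) :
    (∑ i, b i) * f ((∑ i, b i)⁻¹ • ∑ i, x i) ≤ ∑ i, b i * f ((b i)⁻¹ • x i) := by
  have h := hf.map_sum_le (t := Finset.univ) (w := fun i => (∑ j, b j)⁻¹ * b i)
    (p := fun i => (b i)⁻¹ • x i) (fun i _ => by have := hb i; positivity)
    (by rw [← Finset.mul_sum, inv_mul_cancel₀ hB.ne']) (fun i _ => Set.mem_univ _)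
  have hx : ∀ i, ((∑ j, b j)⁻¹ * b i) • (b i)⁻¹ • x i = (∑ j, b j)⁻¹ • x i := fun i => by
    rw [smul_smul, mul_assoc, mul_inv_cancel₀ (hb i).ne', mul_one]
  simp only [hx, smul_eq_mul, mul_assoc, ← Finset.smul_sum, ← Finset.mul_sum] at h
  calc _ ≤ (∑ i, b i) * ((∑ i, b i)⁻¹ * ∑ i, b i * f ((b i)⁻¹ • x i)) := by gcongr
    _ = _ := by rw [mul_inv_cancel_left₀ hB.ne']

/-- The infimal convolution of scaled copies of a convex function is again a scaled copy. -/
theorem wedgeRisk_scaled {k N : ℕ} {ρ : EuclideanSpace ℝ (Fin k) → ℝ}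
    (hρ : ConvexOn ℝ Set.univ ρ) {b : Fin N → ℝ} (hb : ∀ i, 0 < b i) (hB : 0 < ∑ i, b i)
    (R : EuclideanSpace ℝ (Fin k)) :
    wedgeRisk Finset.univ (fun i x => b i * ρ ((b i)⁻¹ • x)) R =
      (∑ i, b i) * ρ ((∑ i, b i)⁻¹ • R) := by
  refine IsLeast.csInf_eq ⟨⟨fun i => (b i / ∑ j, b j) • R, ?_, ?_⟩, ?_⟩
  · rw [← Finset.sum_smul, ← Finset.sum_div, div_self hB.ne', one_smul]
  · rw [Finset.sum_mul]
    refine Finset.sum_congr rfl fun i _ => ?_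
    simp only [smul_smul]
    rw [← mul_div_assoc, inv_mul_cancel₀ (hb i).ne', one_div]
  · rintro _ ⟨x, rfl, rfl⟩
    exact hρ.sum_mul_le_sum_scaled hb hB x

/-- For a strictly risk averse convex function, equality in the scaled Jensen inequality forces
the points to agree with the optimal allocation up to cash. -/
theorem StrictlyRiskAverse.exists_cash_of_sum_scaled_eq {k N : ℕ}
    {rcash : EuclideanSpace ℝ (Fin k)} {ρ : EuclideanSpace ℝ (Fin k) → ℝ}
    (hstrict : StrictlyRiskAverse rcash ρ) (hρ : ConvexOn ℝ Set.univ ρ)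
    {b : Fin N → ℝ} (hb : ∀ i, 0 < b i) (hB : 0 < ∑ i, b i)
    (x : Fin N → EuclideanSpace ℝ (Fin k))
    (hx : ∑ i, b i * ρ ((b i)⁻¹ • x i) = (∑ i, b i) * ρ ((∑ i, b i)⁻¹ • ∑ i, x i)) (i : Fin N) :
    ∃ c : ℝ, (b i)⁻¹ • x i - (∑ j, b j)⁻¹ • ∑ j, x j = c • rcash := by
  by_contra! hne
  set B := ∑ j, b j
  set m := B⁻¹ • ∑ j, x j with hm
  let y : Fin N → EuclideanSpace ℝ (Fin k) := fun j => (1 / 2 : ℝ) • x j + (b j / 2) • m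
  have hy : B⁻¹ • ∑ j, y j = m := by
    simp only [y, Finset.sum_add_distrib, ← Finset.smul_sum, ← Finset.sum_smul,
      ← Finset.sum_div]
    rw [smul_add, smul_comm B⁻¹, ← hm, smul_smul B⁻¹, ← add_smul]
    convert one_smul ℝ m using 2
    change 1 / 2 + B⁻¹ * (B / 2) = 1
    field_simp
    norm_num
  have hyb : ∀ j, (b j)⁻¹ • y j = (1 / 2 : ℝ) • (b j)⁻¹ • x j + (1 - 1 / 2 : ℝ) • m := fun j => by
    have := (hb j).ne'
    simp only [y]
    rw [smul_add, smul_comm, smul_smul (b j)⁻¹ (b j / 2)]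
    congr 2
    field_simp
    norm_num
  have hle := hρ.sum_mul_le_sum_scaled hb hB y
  have hlt : ∑ j, b j * ρ ((b j)⁻¹ • y j) <
      ∑ j, (1 / 2 * (b j * ρ ((b j)⁻¹ • x j)) + 1 / 2 * (b j * ρ m)) := by
    refine Finset.sum_lt_sum (fun j _ => ?_) ⟨i, Finset.mem_univ i, ?_⟩
    · have h := hρ.2 (Set.mem_univ ((b j)⁻¹ • x j)) (Set.mem_univ m)
        (by norm_num : (0 : ℝ) ≤ 1 / 2) (by norm_num : (0 : ℝ) ≤ 1 - 1 / 2) (by norm_num)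
      rw [← hyb j, smul_eq_mul, smul_eq_mul] at h
      linarith [mul_le_mul_of_nonneg_left h (hb j).le]
    · have h := hstrict _ m (1 / 2) (by norm_num) hne
      rw [← hyb i] at h
      linarith [mul_lt_mul_of_pos_left h (hb i)]
  rw [Finset.sum_add_distrib, ← Finset.mul_sum, ← Finset.mul_sum, ← Finset.sum_mul, hx] at hlt
  rw [hy] at hle
  linarith

/-- The cash bundle of a convex risk measure is nonzero. -/
theorem IsConvexRiskMeasure.rcash_ne_zero {k : ℕ} {Ω : Type*} [Fintype Ω]
    {φ : Ω → EuclideanSpace ℝ (Fin k)} {rcash : EuclideanSpace ℝ (Fin k)}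
    {ρ : EuclideanSpace ℝ (Fin k) → ℝ} (h : IsConvexRiskMeasure φ rcash ρ) : rcash ≠ 0 := by
  rintro rfl
  have := h.cash_invariant 0 1
  rw [smul_zero, add_zero] at this
  linarith

/-- **Equilibrium with scaled risk measures.**
Let `ρ` be an expressive, strictly risk averse convex risk measure, `b_i > 0`, and
`ρ_i(r) = b_i ρ(r/b_i)`. With initial total `r⁰ = Σ_i r⁰_i` and
`r_i = (b_i / Σ_j b_j) r⁰`: (a) `∇ρ_i(r_i) = ∇ρ(r⁰/Σ_j b_j)` for every `i`;
(b) `Φ(r) = 0`; (c) `r` is the unique point with total `r⁰` and zero surplus, up to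
zero-sum cash transfers. -/
theorem equilibrium_scaled_risk_measures {k N : ℕ} {Ω : Type*} [Fintype Ω]
    (φ : Ω → EuclideanSpace ℝ (Fin k)) (rcash : EuclideanSpace ℝ (Fin k))
    (hspan : Submodule.span ℝ (Set.range φ) = ⊤)
    (hrcash : ∀ ω, ⟪rcash, φ ω⟫ = 1)
    (ρ : EuclideanSpace ℝ (Fin k) → ℝ)
    (hrisk : IsConvexRiskMeasure φ rcash ρ)
    (hexp : Expressive φ ρ)
    (hstrict : StrictlyRiskAverse rcash ρ)
    (b : Fin N → ℝ) (hb : ∀ i, 0 < b i)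
    (ρi : Fin N → EuclideanSpace ℝ (Fin k) → ℝ)
    (hρi : ∀ i r, ρi i r = b i * ρ ((b i)⁻¹ • r))
    (r0 : Fin N → EuclideanSpace ℝ (Fin k))
    (r : Fin N → EuclideanSpace ℝ (Fin k))
    (hr : ∀ i, r i = (b i / ∑ j, b j) • (∑ j, r0 j)) :
    (∀ i, gradient (ρi i) (r i) = gradient ρ ((∑ j, b j)⁻¹ • (∑ j, r0 j))) ∧
      surplus Finset.univ ρi r = 0 ∧
      ∀ r' : Fin N → EuclideanSpace ℝ (Fin k),
        (∑ i, r' i) = (∑ j, r0 j) → surplus Finset.univ ρi r' = 0 →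
          ∃ c : Fin N → ℝ, (∑ i, c i) = 0 ∧ ∀ i, r' i = r i + c i • rcash := by
  obtain rfl : ρi = fun i x => b i * ρ ((b i)⁻¹ • x) := by
    ext i x
    exact hρi i x
  rcases Nat.eq_zero_or_pos N with rfl | hN
  · refine ⟨fun i => i.elim0, ?_, fun r' _ _ => ⟨0, by simp, fun i => i.elim0⟩⟩
    have hset : {s : ℝ | s = 0} = {0} := rfl
    simp [surplus, wedgeRisk, hset]
  have hB : 0 < ∑ j, b j :=
    Finset.sum_pos (fun i _ => hb i) ⟨⟨0, hN⟩, Finset.mem_univ _⟩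
  have hscale : ∀ i, (b i)⁻¹ • r i = (∑ j, b j)⁻¹ • ∑ j, r0 j := fun i => by
    rw [hr, smul_smul, ← mul_div_assoc, inv_mul_cancel₀ (hb i).ne', one_div]
  have hsum : ∑ i, r i = ∑ j, r0 j := by
    simp only [hr]
    rw [← Finset.sum_smul, ← Finset.sum_div, div_self hB.ne', one_smul]
  refine ⟨fun i => ?_, ?_, fun r' hr' hsur => ?_⟩
  · rw [gradient_scaled hexp.1 (hb i).ne', hscale]
  · rw [surplus, wedgeRisk_scaled hrisk.convex hb hB, hsum, Finset.sum_mul, sub_eq_zero]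
    exact Finset.sum_congr rfl fun i _ => by rw [hscale]
  · rw [surplus, wedgeRisk_scaled hrisk.convex hb hB, sub_eq_zero] at hsur
    choose d hd using hstrict.exists_cash_of_sum_scaled_eq hrisk.convex hb hB r' hsur
    have hdec : ∀ i, r' i = r i + (b i * d i) • rcash := fun i => by
      rw [mul_smul, ← hd i, hr', ← hscale i, smul_sub, smul_inv_smul₀ (hb i).ne',
        smul_inv_smul₀ (hb i).ne', add_sub_cancel]
    refine ⟨fun i => b i * d i, ?_, hdec⟩
    have hzero : (∑ i, b i * d i) • rcash = 0 := by
      have h := hr'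
      simp only [hdec] at h
      rwa [Finset.sum_add_distrib, hsum, add_eq_left, ← Finset.sum_smul] at h
    exact (smul_eq_zero.mp hzero).resolve_right hrisk.rcash_ne_zero
end
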